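/- arXiv:1202.3463 — 4 statements merged into one kernel-verified Lean document; each statement's English description precedes it below -/
import Mathlib

section
/- For all integers m ≥ 1 and k ≥ 1, the assignment sending a generator t of 𝒯_{k−1} to Σ_v ⟨ℓ(v), (t_v, t_v)⟩ — the sum over all univalent vertices v of t, where t_v denotes the rooted tree obtained from t by making v the root and ℓ(v) is the label of v — sends AS and IHX relators of 𝒯_{k−1} to relations in 𝒯_{2k−1}, and hence defines a group homomorphism Δ_{2k−1} : 𝒯_{k−1} → 𝒯_{2k−1}. -/
open scoped TensorProduct

/-- Rooted binary trees (formal non-associative bracket monomials) with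
leaves labeled in `Fin m`.  The degree is the number of leaves, the order is
the degree minus one. -/
inductive RTree (m : ℕ) : Type
  | leaf : Fin m → RTree m
  | node : RTree m → RTree m → RTree m

namespace RTree

/-- The degree of a rooted tree = its number of leaves. -/
def deg {m : ℕ} : RTree m → ℕ
  | leaf _ => 1
  | node a b => deg a + deg b

end RTree

/-- One-hole contexts for rooted trees. -/
inductive Ctx (m : ℕ) : Type
  | hole : Ctx m
  | nodeL : Ctx m → RTree m → Ctx m
  | nodeR : RTree m → Ctx m → Ctx m

/-- Fill the hole of a context with a rooted tree. -/
def Ctx.fill {m : ℕ} : Ctx m → RTree m → RTree m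
  | .hole, t => t
  | .nodeL c r, t => RTree.node (c.fill t) r
  | .nodeR l c, t => RTree.node l (c.fill t)

/-- Relators presenting the degree `n` part `L'_n` of the free quasi-Lie ring:
generators of the wrong degree are killed, and antisymmetry and Jacobi
relators are imposed at every position (one-hole context). -/
def quasiLieRels (m n : ℕ) : Set (FreeAbelianGroup (RTree m)) :=
  {x | ∃ J : RTree m, J.deg ≠ n ∧ x = FreeAbelianGroup.of J} ∪
  {x | ∃ (c : Ctx m) (A B : RTree m),
      x = FreeAbelianGroup.of (c.fill (RTree.node A B)) +
          FreeAbelianGroup.of (c.fill (RTree.node B A))} ∪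
  {x | ∃ (c : Ctx m) (A B C : RTree m),
      x = FreeAbelianGroup.of (c.fill (RTree.node A (RTree.node B C))) -
          FreeAbelianGroup.of (c.fill (RTree.node (RTree.node A B) C)) -
          FreeAbelianGroup.of (c.fill (RTree.node B (RTree.node A C)))}

/-- `L'_n`, the degree `n` part of Levine's free quasi-Lie ring on `X_1,…,X_m`. -/
abbrev Lp (m n : ℕ) :=
  FreeAbelianGroup (RTree m) ⧸ AddSubgroup.closure (quasiLieRels m n)

/-- The canonical projection onto `L'_n`. -/
abbrev LpMk (m n : ℕ) : FreeAbelianGroup (RTree m) →+ Lp m n :=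
  QuotientAddGroup.mk' _

/-- Relators for the free Lie ring: additionally kill all squares `[J,J]`
(at every position). -/
def lieRels (m n : ℕ) : Set (FreeAbelianGroup (RTree m)) :=
  quasiLieRels m n ∪
  {x | ∃ (c : Ctx m) (J : RTree m), x = FreeAbelianGroup.of (c.fill (RTree.node J J))}

/-- `L_n`, the degree `n` part of the free Lie ring on `X_1,…,X_m` over `ℤ`. -/
abbrev LL (m n : ℕ) :=
  FreeAbelianGroup (RTree m) ⧸ AddSubgroup.closure (lieRels m n)

/-- The canonical projection onto `L_n`. -/
abbrev LLMk (m n : ℕ) : FreeAbelianGroup (RTree m) →+ LL m n :=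
  QuotientAddGroup.mk' _

/-- The canonical projection `L'_n → L_n`. -/
def LpToLL (m n : ℕ) : Lp m n →+ LL m n :=
  QuotientAddGroup.map _ _ (AddMonoidHom.id _)
    (by
      rw [AddSubgroup.comap_id]
      exact AddSubgroup.closure_mono Set.subset_union_left)

/-- Free-level bracketing `t ↦ [X i, t]` with a degree one generator. -/
def brLeafFree (m : ℕ) (i : Fin m) :
    FreeAbelianGroup (RTree m) →+ FreeAbelianGroup (RTree m) :=
  FreeAbelianGroup.lift fun t => FreeAbelianGroup.of (RTree.node (RTree.leaf i) t)

theorem brLeafFree_mem_quasi {m n : ℕ} (i : Fin m) {x : FreeAbelianGroup (RTree m)}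
    (hx : x ∈ quasiLieRels m n) :
    brLeafFree m i x ∈ AddSubgroup.closure (quasiLieRels m (n + 1)) := by
  apply AddSubgroup.subset_closure
  rcases hx with (⟨J, hJ, rfl⟩ | ⟨c, A, B, rfl⟩) | ⟨c, A, B, C, rfl⟩
  · refine Or.inl (Or.inl ⟨RTree.node (RTree.leaf i) J, ?_, ?_⟩)
    · simp only [RTree.deg]; omega
    · simp [brLeafFree]
  · refine Or.inl (Or.inr ⟨Ctx.nodeR (RTree.leaf i) c, A, B, ?_⟩)
    simp [brLeafFree, Ctx.fill]
  · refine Or.inr ⟨Ctx.nodeR (RTree.leaf i) c, A, B, C, ?_⟩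
    simp [brLeafFree, Ctx.fill]

theorem brLeafFree_closure_quasi {m n : ℕ} (i : Fin m) :
    AddSubgroup.closure (quasiLieRels m n) ≤
      (AddSubgroup.closure (quasiLieRels m (n + 1))).comap (brLeafFree m i) :=
  (AddSubgroup.closure_le _).2 fun _x hx =>
    AddSubgroup.mem_comap.2 (brLeafFree_mem_quasi i hx)

/-- Bracketing `[X_i, ·] : L'_n → L'_{n+1}` with a degree one generator. -/
def brLeaf (m n : ℕ) (i : Fin m) : Lp m n →+ Lp m (n + 1) :=
  QuotientAddGroup.map _ _ (brLeafFree m i) (brLeafFree_closure_quasi i)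

theorem brLeafFree_mem_lie {m n : ℕ} (i : Fin m) {x : FreeAbelianGroup (RTree m)}
    (hx : x ∈ lieRels m n) :
    brLeafFree m i x ∈ AddSubgroup.closure (lieRels m (n + 1)) := by
  apply AddSubgroup.subset_closure
  rcases hx with ((⟨J, hJ, rfl⟩ | ⟨c, A, B, rfl⟩) | ⟨c, A, B, C, rfl⟩) | ⟨c, J, rfl⟩
  · refine Or.inl (Or.inl (Or.inl ⟨RTree.node (RTree.leaf i) J, ?_, ?_⟩))
    · simp only [RTree.deg]; omega
    · simp [brLeafFree]
  · exact Or.inl (Or.inl (Or.inr ⟨Ctx.nodeR (RTree.leaf i) c, A, B, by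
      simp [brLeafFree, Ctx.fill]⟩))
  · exact Or.inl (Or.inr ⟨Ctx.nodeR (RTree.leaf i) c, A, B, C, by
      simp [brLeafFree, Ctx.fill]⟩)
  · exact Or.inr ⟨Ctx.nodeR (RTree.leaf i) c, J, by simp [brLeafFree, Ctx.fill]⟩

theorem brLeafFree_closure_lie {m n : ℕ} (i : Fin m) :
    AddSubgroup.closure (lieRels m n) ≤
      (AddSubgroup.closure (lieRels m (n + 1))).comap (brLeafFree m i) :=
  (AddSubgroup.closure_le _).2 fun _x hx =>
    AddSubgroup.mem_comap.2 (brLeafFree_mem_lie i hx)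

/-- Bracketing `[X_i, ·] : L_n → L_{n+1}` with a degree one generator. -/
def brLeafL (m n : ℕ) (i : Fin m) : LL m n →+ LL m (n + 1) :=
  QuotientAddGroup.map _ _ (brLeafFree m i) (brLeafFree_closure_lie i)

/-- The bracket map `L'_1 ⊗ L'_a → L'_{a+1}`, `X_i ⊗ Y ↦ [X_i, Y]`,
where `L'_1 = L_1 ≅ ℤ^m` is realized as `FreeAbelianGroup (Fin m)` with basis `X_i`.
The kernel of `bracketLp m (n+1)` is the group `D'_n`. -/
noncomputable def bracketLp (m a : ℕ) :
    (FreeAbelianGroup (Fin m)) ⊗[ℤ] (Lp m a) →ₗ[ℤ] Lp m (a + 1) :=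
  TensorProduct.lift
    ((FreeAbelianGroup.lift fun i => (brLeaf m a i).toIntLinearMap).toIntLinearMap)

/-- The bracket map `L_1 ⊗ L_a → L_{a+1}`.  The kernel of `bracketLL m (n+1)` is `D_n`. -/
noncomputable def bracketLL (m a : ℕ) :
    (FreeAbelianGroup (Fin m)) ⊗[ℤ] (LL m a) →ₗ[ℤ] LL m (a + 1) :=
  TensorProduct.lift
    ((FreeAbelianGroup.lift fun i => (brLeafL m a i).toIntLinearMap).toIntLinearMap)

/-- `id ⊗ proj : L_1 ⊗ L'_n → L_1 ⊗ L_n`. -/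
noncomputable def projT (m n : ℕ) :
    (FreeAbelianGroup (Fin m)) ⊗[ℤ] (Lp m n) →ₗ[ℤ]
      (FreeAbelianGroup (Fin m)) ⊗[ℤ] (LL m n) :=
  LinearMap.lTensor _ (LpToLL m n).toIntLinearMap

/-- Given a rooted tree `t` and a rooted tree `rest` (representing the rest of the
unrooted tree `⟨t, rest⟩` hanging off the root edge of `t`), list, for each leaf `v`
of `t`, the label of `v` together with the rooted tree obtained from the unrooted
tree `⟨t, rest⟩` by making `v` the root. -/
def rerootList {m : ℕ} : RTree m → RTree m → List (Fin m × RTree m)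
  | RTree.leaf i, rest => [(i, rest)]
  | RTree.node a b, rest =>
      rerootList a (RTree.node b rest) ++ rerootList b (RTree.node rest a)

/-- All univalent vertices of the unrooted tree `⟨p.1, p.2⟩`, together with the
corresponding rerooted trees. -/
def pairReroots {m : ℕ} (p : RTree m × RTree m) : List (Fin m × RTree m) :=
  rerootList p.1 p.2 ++ rerootList p.2 p.1

/-- Relators presenting the order `n` tree group `𝒯_n`.  An unrooted unitrivalent
labeled vertex-oriented tree is presented as the inner product `⟨I,J⟩` of a pair of
rooted trees (cutting an edge); generators of the wrong order are killed, and we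
impose: symmetry `⟨I,J⟩ = ⟨J,I⟩`, edge-sliding `⟨(A,B),C⟩ = ⟨A,(B,C)⟩` (both of
which express that the pair presents the same unrooted tree), antisymmetry (AS),
and Jacobi (IHX) relations. -/
def treeRels (m n : ℕ) : Set (FreeAbelianGroup (RTree m × RTree m)) :=
  {x | ∃ p : RTree m × RTree m, p.1.deg + p.2.deg ≠ n + 2 ∧ x = FreeAbelianGroup.of p} ∪
  {x | ∃ I J : RTree m, x = FreeAbelianGroup.of (I, J) - FreeAbelianGroup.of (J, I)} ∪
  {x | ∃ A B C : RTree m,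
      x = FreeAbelianGroup.of (RTree.node A B, C) - FreeAbelianGroup.of (A, RTree.node B C)} ∪
  {x | ∃ A B C : RTree m,
      x = FreeAbelianGroup.of (RTree.node A B, C) + FreeAbelianGroup.of (RTree.node B A, C)} ∪
  {x | ∃ A B C D : RTree m,
      x = FreeAbelianGroup.of (RTree.node A (RTree.node B C), D)
        - FreeAbelianGroup.of (RTree.node (RTree.node A B) C, D)
        - FreeAbelianGroup.of (RTree.node B (RTree.node A C), D)}

/-- `𝒯_n`, the order `n` tree group. -/
abbrev Tgrp (m n : ℕ) :=
  FreeAbelianGroup (RTree m × RTree m) ⧸ AddSubgroup.closure (treeRels m n)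

/-- The canonical projection onto `𝒯_n`; the generator `⟨I,J⟩` is `TMk m n (.of (I,J))`. -/
abbrev TMk (m n : ℕ) : FreeAbelianGroup (RTree m × RTree m) →+ Tgrp m n :=
  QuotientAddGroup.mk' _

/-- The boundary-twist relators `⟨(i,J),J⟩` (for `J` of order `k-1`, i.e. degree `k`). -/
def btRels (m k : ℕ) : Set (FreeAbelianGroup (RTree m × RTree m)) :=
  {x | ∃ (i : Fin m) (J : RTree m), J.deg = k ∧
      x = FreeAbelianGroup.of (RTree.node (RTree.leaf i) J, J)}

/-- `𝒯^∞_{2k-1}`, the quotient of `𝒯_{2k-1}` by the boundary-twist relations. -/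
abbrev Tinfodd (m k : ℕ) :=
  FreeAbelianGroup (RTree m × RTree m) ⧸
    AddSubgroup.closure (treeRels m (2 * k - 1) ∪ btRels m k)

abbrev TinfoddMk (m k : ℕ) : FreeAbelianGroup (RTree m × RTree m) →+ Tinfodd m k :=
  QuotientAddGroup.mk' _

/-- Relators presenting `𝒯^∞_{2k}`: generators are order `2k` unrooted trees
(`Sum.inl` of a pair of rooted trees, as in `treeRels`) together with `∞`-trees
`J^∞` (`Sum.inr J`) for rooted trees `J` of order `k` (degree `k+1`).  Relations:
the relations of `𝒯_{2k}` among the non-`∞` trees, wrong-degree `∞`-generators are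
killed, the symmetry relations `(-J)^∞ = J^∞`, the twisted IHX relations
`I^∞ = H^∞ + X^∞ - ⟨H,X⟩`, and the interior-twist relations `2 J^∞ = ⟨J,J⟩`. -/
def tinfRels (m k : ℕ) : Set (FreeAbelianGroup ((RTree m × RTree m) ⊕ RTree m)) :=
  (⇑(FreeAbelianGroup.map (Sum.inl : RTree m × RTree m → (RTree m × RTree m) ⊕ RTree m)) ''
      treeRels m (2 * k)) ∪
  {x | ∃ J : RTree m, J.deg ≠ k + 1 ∧ x = FreeAbelianGroup.of (Sum.inr J)} ∪
  {x | ∃ (c : Ctx m) (A B : RTree m),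
      x = FreeAbelianGroup.of (Sum.inr (c.fill (RTree.node A B)))
        - FreeAbelianGroup.of (Sum.inr (c.fill (RTree.node B A)))} ∪
  {x | ∃ (c : Ctx m) (A B C : RTree m),
      x = FreeAbelianGroup.of (Sum.inr (c.fill (RTree.node A (RTree.node B C))))
        - FreeAbelianGroup.of (Sum.inr (c.fill (RTree.node (RTree.node A B) C)))
        - FreeAbelianGroup.of (Sum.inr (c.fill (RTree.node B (RTree.node A C))))
        + FreeAbelianGroup.of (Sum.inl (c.fill (RTree.node (RTree.node A B) C),
            c.fill (RTree.node B (RTree.node A C))))} ∪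
  {x | ∃ J : RTree m,
      x = FreeAbelianGroup.of (Sum.inr J) + FreeAbelianGroup.of (Sum.inr J)
        - FreeAbelianGroup.of (Sum.inl (J, J))}

/-- `𝒯^∞_{2k}`, the twisted tree group in even order `2k`. -/
abbrev Tinf (m k : ℕ) :=
  FreeAbelianGroup ((RTree m × RTree m) ⊕ RTree m) ⧸ AddSubgroup.closure (tinfRels m k)

abbrev TinfMk (m k : ℕ) :
    FreeAbelianGroup ((RTree m × RTree m) ⊕ RTree m) →+ Tinf m k :=
  QuotientAddGroup.mk' _

/-- The degree-guarded free-level bracket: for `s, t` rooted trees,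
`brFree m a b (of s) (of t) = of [s,t]` if `s` has degree `a` and `t` degree `b`,
and `0` otherwise.  It induces the bracket `L'_a × L'_b → L'_{a+b}`. -/
def brFree (m a b : ℕ) :
    FreeAbelianGroup (RTree m) →+
      FreeAbelianGroup (RTree m) →+ FreeAbelianGroup (RTree m) :=
  FreeAbelianGroup.lift fun s =>
    FreeAbelianGroup.lift fun t =>
      if s.deg = a ∧ t.deg = b then FreeAbelianGroup.of (RTree.node s t) else 0

namespace Tgrp

variable {m n : ℕ}

/-- The generator `⟨I,J⟩` of `𝒯_n`. -/
def inner (n : ℕ) (I J : RTree m) : Tgrp m n := TMk m n (FreeAbelianGroup.of (I, J))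

theorem TMk_eq_zero {x : FreeAbelianGroup (RTree m × RTree m)} (hx : x ∈ treeRels m n) :
    TMk m n x = 0 :=
  (QuotientAddGroup.eq_zero_iff x).2 (AddSubgroup.subset_closure hx)

theorem inner_eq_zero {I J : RTree m} (h : I.deg + J.deg ≠ n + 2) : inner n I J = 0 :=
  TMk_eq_zero (Or.inl (Or.inl (Or.inl (Or.inl ⟨(I, J), h, rfl⟩))))

theorem inner_comm (I J : RTree m) : inner n I J = inner n J I := by
  have h := TMk_eq_zero (n := n) (Or.inl (Or.inl (Or.inl (Or.inr ⟨I, J, rfl⟩))))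
  rwa [map_sub, sub_eq_zero] at h

theorem inner_node_left (A B C : RTree m) :
    inner n (A.node B) C = inner n A (B.node C) := by
  have h := TMk_eq_zero (n := n) (Or.inl (Or.inl (Or.inr ⟨A, B, C, rfl⟩)))
  rwa [map_sub, sub_eq_zero] at h

theorem inner_node_rotate (A B C : RTree m) :
    inner n (A.node B) C = inner n B (C.node A) := by
  rw [inner_comm, ← inner_node_left, inner_comm]

/-- Pairing against all rooted trees: the linear class of a rooted tree in `𝒯_n`. -/
def pairing (n : ℕ) (J : RTree m) : RTree m → Tgrp m n := inner n J

theorem pairing_node_swap (A B : RTree m) :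
    pairing n (A.node B) = -pairing n (B.node A) := by
  funext C
  have h := TMk_eq_zero (n := n) (Or.inl (Or.inr ⟨A, B, C, rfl⟩))
  rw [map_add] at h
  exact eq_neg_of_add_eq_zero_left h

theorem pairing_jacobi (A B C : RTree m) :
    pairing n (A.node (B.node C)) =
      pairing n ((A.node B).node C) + pairing n (B.node (A.node C)) := by
  funext D
  have h := TMk_eq_zero (n := n) (Or.inr ⟨A, B, C, D, rfl⟩)
  rw [map_sub, map_sub, sub_sub, sub_eq_zero] at h
  exact h

theorem pairing_node_left (A B : RTree m) :
    pairing n (A.node B) = fun D => pairing n A (B.node D) :=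
  funext fun D => inner_node_left A B D

theorem pairing_node_right (A B : RTree m) :
    pairing n (A.node B) = fun D => pairing n B (D.node A) :=
  funext fun D => inner_node_rotate A B D

theorem pairing_node_right_neg {J K : RTree m} (h : pairing n J = -pairing n K)
    (A : RTree m) : pairing n (A.node J) = -pairing n (A.node K) := by
  simp only [pairing_node_right, h]; rfl

theorem pairing_node_left_neg {J K : RTree m} (h : pairing n J = -pairing n K)
    (A : RTree m) : pairing n (J.node A) = -pairing n (K.node A) := by
  simp only [pairing_node_left, h]; rfl

theorem pairing_node_right_add {I H X : RTree m}
    (h : pairing n I = pairing n H + pairing n X) (A : RTree m) :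
    pairing n (A.node I) = pairing n (A.node H) + pairing n (A.node X) := by
  simp only [pairing_node_right, h]; rfl

theorem pairing_node_left_add {I H X : RTree m}
    (h : pairing n I = pairing n H + pairing n X) (A : RTree m) :
    pairing n (I.node A) = pairing n (H.node A) + pairing n (X.node A) := by
  simp only [pairing_node_left, h]; rfl

theorem inner_node_right (L J K : RTree m) :
    inner n L (J.node K) = pairing n J (K.node L) := by
  rw [inner_comm, inner_node_left]; rfl

theorem inner_node_right_rotate (L J K : RTree m) :
    inner n L (J.node K) = pairing n K (L.node J) := by
  rw [inner_comm, inner_node_rotate]; rfl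

theorem inner_node_swap_right (L J K : RTree m) :
    inner n L (J.node K) = -inner n L (K.node J) := by
  rw [inner_comm, inner_comm L]
  exact congrFun (pairing_node_swap J K) L

theorem inner_square_neg {J K : RTree m} (h : pairing n J = -pairing n K) (L : RTree m) :
    inner n L (J.node J) = inner n L (K.node K) := by
  rw [inner_node_right, h, Pi.neg_apply, ← inner_node_right, inner_node_right_rotate, h,
    Pi.neg_apply, neg_neg, ← inner_node_right_rotate]

theorem inner_square_add {I H X : RTree m}
    (h : pairing n I = pairing n H + pairing n X) (L : RTree m) :
    inner n L (I.node I) = inner n L (H.node H) + inner n L (X.node X) := by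
  rw [inner_node_right, h, Pi.add_apply, ← inner_node_right, ← inner_node_right,
    inner_node_right_rotate, inner_node_right_rotate L X I, h, Pi.add_apply, Pi.add_apply,
    ← inner_node_right_rotate, ← inner_node_right_rotate, ← inner_node_right_rotate,
    ← inner_node_right_rotate,
    inner_node_swap_right L H X]
  abel

/-- `Σ_v ⟨ℓ(v), (v.2, v.2)⟩` over the leaves `v` of `t` in the unrooted tree `⟨t, r⟩`. -/
def rerootSum (n : ℕ) (t r : RTree m) : Tgrp m n :=
  ((rerootList t r).map fun v => inner n (RTree.leaf v.1) (v.2.node v.2)).sum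

theorem rerootSum_leaf (i : Fin m) (r : RTree m) :
    rerootSum n (RTree.leaf i) r = inner n (RTree.leaf i) (r.node r) := by
  simp [rerootSum, rerootList]

theorem rerootSum_node (a b r : RTree m) :
    rerootSum n (a.node b) r = rerootSum n a (b.node r) + rerootSum n b (r.node a) := by
  simp [rerootSum, rerootList]

theorem rerootSum_add_self (t r : RTree m) : rerootSum n t r + rerootSum n t r = 0 := by
  induction t generalizing r with
  | leaf i =>
    rw [rerootSum_leaf]
    exact eq_neg_iff_add_eq_zero.1 (inner_node_swap_right _ r r)
  | node a b iha ihb => rw [rerootSum_node, add_add_add_comm, iha, ihb, add_zero]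

theorem rerootSum_neg {J K : RTree m} (h : pairing n J = -pairing n K) (t : RTree m) :
    rerootSum n t J = rerootSum n t K := by
  induction t generalizing J K with
  | leaf i => rw [rerootSum_leaf, rerootSum_leaf, inner_square_neg h]
  | node a b iha ihb =>
    rw [rerootSum_node, rerootSum_node, iha (pairing_node_right_neg h b),
      ihb (pairing_node_left_neg h a)]

theorem rerootSum_add {I H X : RTree m}
    (h : pairing n I = pairing n H + pairing n X) (t : RTree m) :
    rerootSum n t I = rerootSum n t H + rerootSum n t X := by
  induction t generalizing I H X with
  | leaf i => rw [rerootSum_leaf, rerootSum_leaf, rerootSum_leaf, inner_square_add h]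
  | node a b iha ihb =>
    rw [rerootSum_node, rerootSum_node, rerootSum_node, iha (pairing_node_right_add h b),
      ihb (pairing_node_left_add h a), add_add_add_comm]

theorem rerootSum_node_swap (t A B : RTree m) :
    rerootSum n t (A.node B) = rerootSum n t (B.node A) :=
  rerootSum_neg (pairing_node_swap A B) t

theorem rerootSum_node_swap_right (t A B C : RTree m) :
    rerootSum n t (A.node (B.node C)) = rerootSum n t (A.node (C.node B)) :=
  rerootSum_neg (pairing_node_right_neg (pairing_node_swap B C) A) t

theorem rerootSum_jacobi (t A B C : RTree m) :
    rerootSum n t (A.node (B.node C)) =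
      rerootSum n t ((A.node B).node C) + rerootSum n t (B.node (A.node C)) :=
  rerootSum_add (pairing_jacobi A B C) t

theorem rerootSum_eq_zero {t r : RTree m} (h : 2 * (t.deg + r.deg) ≠ n + 3) :
    rerootSum n t r = 0 := by
  induction t generalizing r with
  | leaf i =>
    rw [rerootSum_leaf]
    exact inner_eq_zero (by simp only [RTree.deg] at h ⊢; omega)
  | node a b iha ihb =>
    rw [rerootSum_node, iha (by simp only [RTree.deg] at h ⊢; omega),
      ihb (by simp only [RTree.deg] at h ⊢; omega), add_zero]

/-- The map `⟨I,J⟩ ↦ Σ_v ⟨ℓ(v), (t_v, t_v)⟩` on free generators. -/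
def deltaFree (m n : ℕ) : FreeAbelianGroup (RTree m × RTree m) →+ Tgrp m n :=
  FreeAbelianGroup.lift fun p => rerootSum n p.1 p.2 + rerootSum n p.2 p.1

theorem deltaFree_of (I J : RTree m) :
    deltaFree m n (FreeAbelianGroup.of (I, J)) = rerootSum n I J + rerootSum n J I := by
  simp [deltaFree]

theorem deltaFree_eq_zero {l : ℕ} (hl : n = 2 * l + 1)
    {x : FreeAbelianGroup (RTree m × RTree m)} (hx : x ∈ treeRels m l) :
    deltaFree m n x = 0 := by
  rcases hx with (((⟨⟨I, J⟩, hp, rfl⟩ | ⟨I, J, rfl⟩) | ⟨A, B, C, rfl⟩) | ⟨A, B, C, rfl⟩) |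
    ⟨A, B, C, D, rfl⟩
  · rw [deltaFree_of, rerootSum_eq_zero (by dsimp only at hp; omega),
      rerootSum_eq_zero (by dsimp only at hp; omega), add_zero]
  · rw [map_sub, deltaFree_of, deltaFree_of, add_comm, sub_self]
  · simp only [map_sub, deltaFree_of, rerootSum_node]
    abel
  · simp only [map_add, deltaFree_of, rerootSum_node]
    rw [rerootSum_node_swap A C B, rerootSum_node_swap B A C, rerootSum_node_swap C B A]
    linear_combination (norm := module) rerootSum_add_self (n := n) A (B.node C) +
      rerootSum_add_self (n := n) B (C.node A) + rerootSum_add_self (n := n) C (A.node B)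
  · simp only [map_sub, deltaFree_of, rerootSum_node]
    have hA := rerootSum_jacobi (n := n) A B C D
    have hB := rerootSum_jacobi (n := n) B C D A
    have hC := rerootSum_jacobi (n := n) C D A B
    have hD := rerootSum_jacobi (n := n) D A B C
    rw [rerootSum_node_swap_right A C B D] at hA
    rw [rerootSum_node_swap_right B D C A, rerootSum_node_swap B D (A.node C)] at hB
    rw [rerootSum_node_swap C A (D.node B)] at hC
    linear_combination (norm := module) hB + hD - hA - hC -
      rerootSum_add_self (n := n) A (C.node (D.node B)) -
      rerootSum_add_self (n := n) C ((D.node B).node A)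

end Tgrp

/-- For all `m ≥ 1`, `k ≥ 1`, the assignment sending a generator `t = ⟨I,J⟩`
of `𝒯_{k-1}` to `Σ_v ⟨ℓ(v), (t_v, t_v)⟩` (sum over all univalent vertices `v` of `t`,
where `t_v` is the rooted tree obtained by making `v` the root and `ℓ(v)` its label)
respects the relations and hence defines a homomorphism `Δ_{2k-1} : 𝒯_{k-1} → 𝒯_{2k-1}`. -/
theorem statement0 (m k : ℕ) (hm : 1 ≤ m) (hk : 1 ≤ k) :
    ∃ Δ : Tgrp m (k - 1) →+ Tgrp m (2 * k - 1),
      ∀ p : RTree m × RTree m, p.1.deg + p.2.deg = (k - 1) + 2 →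
        Δ (TMk m (k - 1) (FreeAbelianGroup.of p)) =
          ((pairReroots p).map fun v =>
            TMk m (2 * k - 1)
              (FreeAbelianGroup.of (RTree.leaf v.1, RTree.node v.2 v.2))).sum := by
  refine ⟨QuotientAddGroup.lift _ (Tgrp.deltaFree m (2 * k - 1))
    ((AddSubgroup.closure_le _).2 fun x hx =>
      Tgrp.deltaFree_eq_zero (by omega) hx), fun p _ => ?_⟩
  rw [pairReroots, List.map_append, List.sum_append]
  exact Tgrp.deltaFree_of p.1 p.2
end

section
/- For all integers m ≥ 1 and k ≥ 1 and every x ∈ 𝒯_{k−1}, one has 2·Δ_{2k−1}(x) = 0 in 𝒯_{2k−1}; consequently Δ_{2k−1} factors through ℤ₂ ⊗ 𝒯_{k−1}. -/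
open scoped TensorProduct

theorem two_nsmul_TMk_leaf_node_self {m n : ℕ} (i : Fin m) (J : RTree m) :
    2 • TMk m n (FreeAbelianGroup.of (RTree.leaf i, RTree.node J J)) = 0 := by
  have symm : TMk m n (FreeAbelianGroup.of (RTree.node J J, RTree.leaf i)) =
      TMk m n (FreeAbelianGroup.of (RTree.leaf i, RTree.node J J)) := by
    rw [← sub_eq_zero, ← map_sub]
    exact (QuotientAddGroup.eq_zero_iff _).2 <| AddSubgroup.subset_closure <|
      Or.inl <| Or.inl <| Or.inl <| Or.inr ⟨_, _, rfl⟩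
  rw [← symm, two_nsmul, ← map_add]
  exact (QuotientAddGroup.eq_zero_iff _).2 <| AddSubgroup.subset_closure <|
    Or.inl <| Or.inr ⟨J, J, RTree.leaf i, rfl⟩

theorem TMk_of_eq_zero {m n : ℕ} {p : RTree m × RTree m} (hp : p.1.deg + p.2.deg ≠ n + 2) :
    TMk m n (FreeAbelianGroup.of p) = 0 :=
  (QuotientAddGroup.eq_zero_iff _).2 <| AddSubgroup.subset_closure <|
    Or.inl <| Or.inl <| Or.inl <| Or.inl ⟨p, hp, rfl⟩

theorem Tgrp.hom_ext {m n : ℕ} {G : Type*} [AddCommGroup G] {f g : Tgrp m n →+ G}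
    (h : ∀ p : RTree m × RTree m, p.1.deg + p.2.deg = n + 2 →
      f (TMk m n (FreeAbelianGroup.of p)) = g (TMk m n (FreeAbelianGroup.of p))) : f = g := by
  refine QuotientAddGroup.addMonoidHom_ext _ (FreeAbelianGroup.lift_ext _ _ fun p => ?_)
  by_cases hp : p.1.deg + p.2.deg = n + 2
  · exact h p hp
  · change f (TMk m n _) = g (TMk m n _)
    rw [TMk_of_eq_zero hp, map_zero, map_zero]

/-- A homomorphism of abelian groups killed by `n` factors through `ZMod n ⊗ -`. -/
theorem exists_zmod_tensor_factor {A B : Type*} [AddCommGroup A] [AddCommGroup B] (n : ℕ)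
    (f : A →+ B) (hf : n • f = 0) :
    ∃ g : (ZMod n ⊗[ℤ] A) →+ B, ∀ x : A, g ((1 : ZMod n) ⊗ₜ[ℤ] x) = f x := by
  let φ : ZMod n →+ A →+ B := ZMod.lift n ⟨zmultiplesHom (A →+ B) f, by simpa using hf⟩
  refine ⟨TensorProduct.liftAddHom φ fun r a x => by
    rw [map_zsmul, map_zsmul, AddMonoidHom.zsmul_apply], fun x => ?_⟩
  have h : φ 1 = f := by
    simpa using ZMod.lift_coe n ⟨zmultiplesHom (A →+ B) f, by simpa using hf⟩ 1
  rw [TensorProduct.liftAddHom_tmul, h]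

/-- For all `m ≥ 1`, `k ≥ 1` and every `x ∈ 𝒯_{k-1}`, `2·Δ_{2k-1}(x) = 0`
in `𝒯_{2k-1}`; consequently `Δ_{2k-1}` factors through `ℤ₂ ⊗ 𝒯_{k-1}`. -/
theorem statement1 (m k : ℕ) (hm : 1 ≤ m) (hk : 1 ≤ k)
    (Δ : Tgrp m (k - 1) →+ Tgrp m (2 * k - 1))
    (hΔ : ∀ p : RTree m × RTree m, p.1.deg + p.2.deg = (k - 1) + 2 →
      Δ (TMk m (k - 1) (FreeAbelianGroup.of p)) =
        ((pairReroots p).map fun v =>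
          TMk m (2 * k - 1)
            (FreeAbelianGroup.of (RTree.leaf v.1, RTree.node v.2 v.2))).sum) :
    (∀ x : Tgrp m (k - 1), 2 • Δ x = 0) ∧
    ∃ Δ₂ : ((ZMod 2) ⊗[ℤ] (Tgrp m (k - 1))) →+ Tgrp m (2 * k - 1),
      ∀ x : Tgrp m (k - 1), Δ₂ ((1 : ZMod 2) ⊗ₜ[ℤ] x) = Δ x := by
  have h : 2 • Δ = 0 := Tgrp.hom_ext fun p hp => by
    rw [AddMonoidHom.nsmul_apply, hΔ p hp, AddMonoidHom.zero_apply, List.smul_sum, List.map_map]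
    refine List.sum_eq_zero fun y hy => ?_
    obtain ⟨v, -, rfl⟩ := List.mem_map.1 hy
    exact two_nsmul_TMk_leaf_node_self v.1 v.2
  exact ⟨fun x => DFunLike.congr_fun h x, exists_zmod_tensor_factor 2 Δ h⟩
end

section
/- For all integers m ≥ 1, k ≥ 1, every label i ∈ {1,…,m} and every rooted tree J of order k−1, one has η'_{2k−1}(⟨i,(J,J)⟩) = X_i ⊗ [J,J] in L'_1 ⊗ L'_{2k}. -/
open scoped TensorProduct

theorem LpMk_fill_node_swap {m : ℕ} (n : ℕ) (c : Ctx m) (A B : RTree m) :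
    LpMk m n (FreeAbelianGroup.of (c.fill (RTree.node A B))) +
      LpMk m n (FreeAbelianGroup.of (c.fill (RTree.node B A))) = 0 := by
  rw [← map_add]
  exact (QuotientAddGroup.eq_zero_iff _).2
    (AddSubgroup.subset_closure (Or.inl (Or.inr ⟨c, A, B, rfl⟩)))

/-- The sum over the leaves of `t` of the rerooted trees is antisymmetric in every
trivalent vertex of the tree attached to the root of `t`. -/
theorem sum_rerootList_fill_node_swap {m : ℕ} (n : ℕ) (t : RTree m) (c : Ctx m)
    (A B : RTree m) :
    ((rerootList t (c.fill (RTree.node A B))).map fun v =>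
        (FreeAbelianGroup.of v.1) ⊗ₜ[ℤ] (LpMk m n (FreeAbelianGroup.of v.2))).sum +
      ((rerootList t (c.fill (RTree.node B A))).map fun v =>
        (FreeAbelianGroup.of v.1) ⊗ₜ[ℤ] (LpMk m n (FreeAbelianGroup.of v.2))).sum = 0 := by
  induction t generalizing c with
  | leaf i =>
    simp only [rerootList, List.map_cons, List.map_nil, List.sum_cons, List.sum_nil, add_zero]
    rw [← TensorProduct.tmul_add, LpMk_fill_node_swap, TensorProduct.tmul_zero]
  | node a b iha ihb =>
    simp only [rerootList, List.map_append, List.sum_append]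
    rw [add_add_add_comm]
    exact (congrArg₂ (· + ·) (iha (Ctx.nodeR b c)) (ihb (Ctx.nodeL c a))).trans (add_zero 0)

/-- For all `m,k ≥ 1`, every label `i` and every rooted tree `J` of
order `k-1` (degree `k`), one has `η'_{2k-1}(⟨i,(J,J)⟩) = X_i ⊗ [J,J]` in
`L'_1 ⊗ L'_{2k}`. -/
theorem statement3 (m k : ℕ) (hm : 1 ≤ m) (hk : 1 ≤ k)
    (i : Fin m) (J : RTree m) (hJ : J.deg = k) :
    ((pairReroots (RTree.leaf i, RTree.node J J)).map fun v =>
        (FreeAbelianGroup.of v.1) ⊗ₜ[ℤ]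
          (LpMk m (2 * k) (FreeAbelianGroup.of v.2))).sum
      = (FreeAbelianGroup.of i) ⊗ₜ[ℤ]
          (LpMk m (2 * k) (FreeAbelianGroup.of (RTree.node J J))) := by
  simp only [pairReroots, rerootList, List.map_append, List.sum_append, List.map_cons,
    List.map_nil, List.sum_cons, List.sum_nil, add_zero]
  exact (congrArg _ (sum_rerootList_fill_node_swap (2 * k) J Ctx.hole J (RTree.leaf i))).trans
    (add_zero _)
end

section
/- For all integers m ≥ 1, k ≥ 1 and every generator t of 𝒯_{k−1}, one has η'_{2k−1}(Δ_{2k−1}(t)) = Σ_v X_{ℓ(v)} ⊗ [T'_v(t), T'_v(t)] in L'_1 ⊗ L'_{2k}, the sum over all univalent vertices v of t. -/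
open scoped TensorProduct

theorem LpMk_antisymm (m n : ℕ) (c : Ctx m) (A B : RTree m) :
    LpMk m n (FreeAbelianGroup.of (c.fill (RTree.node A B))) +
      LpMk m n (FreeAbelianGroup.of (c.fill (RTree.node B A))) = 0 := by
  rw [← map_add]
  exact (QuotientAddGroup.eq_zero_iff _).2
    (AddSubgroup.subset_closure (Or.inl (Or.inr ⟨c, A, B, rfl⟩)))

/-- Swapping the two branches at a trivalent vertex of the complementary tree negates the
sum over all rerootings at leaves of `T`. -/
theorem sum_rerootList_antisymm (m n : ℕ) (A B T : RTree m) (c : Ctx m) :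
    ((rerootList T (c.fill (RTree.node A B))).map fun w =>
        (FreeAbelianGroup.of w.1) ⊗ₜ[ℤ] (LpMk m n (FreeAbelianGroup.of w.2))).sum +
      ((rerootList T (c.fill (RTree.node B A))).map fun w =>
        (FreeAbelianGroup.of w.1) ⊗ₜ[ℤ] (LpMk m n (FreeAbelianGroup.of w.2))).sum = 0 := by
  induction T generalizing c with
  | leaf i =>
    simp only [rerootList, List.map_cons, List.map_nil, List.sum_cons, List.sum_nil, add_zero]
    rw [← TensorProduct.tmul_add, LpMk_antisymm, TensorProduct.tmul_zero]
  | node a b iha ihb =>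
    have ha := iha (Ctx.nodeR b c)
    have hb := ihb (Ctx.nodeL c a)
    simp only [Ctx.fill] at ha hb
    simp only [rerootList, List.map_append, List.sum_append]
    rw [add_add_add_comm, ha, hb, add_zero]

/-- For all `m,k ≥ 1` and every generator `t = ⟨I,J⟩` of `𝒯_{k-1}`,
one has `η'_{2k-1}(Δ_{2k-1}(t)) = Σ_v X_{ℓ(v)} ⊗ [T'_v(t), T'_v(t)]` in
`L'_1 ⊗ L'_{2k}`, the sum over all univalent vertices `v` of `t`.
Both sides are written out explicitly:
`Δ_{2k-1}(t) = Σ_v ⟨ℓ(v),(t_v,t_v)⟩` and `η'_{2k-1}` is applied termwise. -/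
theorem statement4 (m k : ℕ) (hm : 1 ≤ m) (hk : 1 ≤ k)
    (p : RTree m × RTree m) (hp : p.1.deg + p.2.deg = (k - 1) + 2) :
    ((pairReroots p).map fun v =>
        ((pairReroots (RTree.leaf v.1, RTree.node v.2 v.2)).map fun w =>
          (FreeAbelianGroup.of w.1) ⊗ₜ[ℤ]
            (LpMk m (2 * k) (FreeAbelianGroup.of w.2))).sum).sum
      = ((pairReroots p).map fun v =>
          (FreeAbelianGroup.of v.1) ⊗ₜ[ℤ]
            (LpMk m (2 * k) (FreeAbelianGroup.of (RTree.node v.2 v.2)))).sum := by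
  congr 2
  funext v
  have h := sum_rerootList_antisymm m (2 * k) v.2 (RTree.leaf v.1) v.2 Ctx.hole
  simp only [Ctx.fill] at h
  simp only [pairReroots, rerootList, List.map_append, List.sum_append, List.map_cons,
    List.map_nil, List.sum_cons, List.sum_nil, add_zero]
  rw [h, add_zero]
end
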